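/- Let ‖·‖ be a norm on c₀₀ satisfying the Schlumprecht implicit equation. Then for every y ∈ c₀₀ with ‖y‖ ≤ 1 and every n ≥ 1, ∑_{i=1}^n |y_i| + ‖y − P_n y‖ ≤ log₂(n+2), where P_n y is the restriction of y to coordinates 1,…,n. -/

import Mathlib

open Filter Topology

/-- The coordinatewise restriction of a finitely supported sequence to a finite index set. -/
noncomputable def restrF (E : Finset ℕ) (ξ : ℕ →₀ ℝ) : ℕ →₀ ℝ :=
  Finsupp.filter (· ∈ E) ξ

/-- The sup-norm of a finitely supported sequence. -/
noncomputable def supNormF (ξ : ℕ →₀ ℝ) : ℝ := ⨆ i, |ξ i|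

/-- The set of values appearing in the inner supremum of the Schlumprecht implicit
equation: all numbers `(1/log₂(k+1)) ∑_{j<k} ‖E_j ξ‖` over chains `E 0 < ... < E (k-1)`
of nonempty finite sets with `k ≥ 2`. -/
noncomputable def schlumprechtSet (nrm : (ℕ →₀ ℝ) → ℝ) (ξ : ℕ →₀ ℝ) : Set ℝ :=
  {r | ∃ (k : ℕ) (E : ℕ → Finset ℕ), 2 ≤ k ∧
    (∀ j < k, (E j).Nonempty) ∧
    (∀ j, j + 1 < k → ∀ a ∈ E j, ∀ b ∈ E (j + 1), a < b) ∧
    r = (1 / Real.logb 2 (k + 1)) * ∑ j ∈ Finset.range k, nrm (restrF (E j) ξ)}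

/-- `nrm` is a norm on `c₀₀` satisfying the Schlumprecht implicit equation. -/
def IsSchlumprechtNorm (nrm : (ℕ →₀ ℝ) → ℝ) : Prop :=
  (∀ ξ η, nrm (ξ + η) ≤ nrm ξ + nrm η) ∧
  (∀ (c : ℝ) (ξ), nrm (c • ξ) = |c| * nrm ξ) ∧
  (∀ ξ, nrm ξ = 0 ↔ ξ = 0) ∧
  (∀ ξ, nrm ξ = max (supNormF ξ) (sSup (schlumprechtSet nrm ξ)))


lemma sch_chain_lt (k : ℕ) (E : ℕ → Finset ℕ) (h1 : ∀ j < k, (E j).Nonempty)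
    (h2 : ∀ j, j + 1 < k → ∀ a ∈ E j, ∀ b ∈ E (j + 1), a < b) (i d : ℕ) :
    i + d + 1 < k → ∀ a ∈ E i, ∀ b ∈ E (i + d + 1), a < b := by
  induction d with
  | zero => intro hk; exact h2 i hk
  | succ d ih =>
    intro hk a ha b hb
    obtain ⟨c, hc⟩ := h1 (i + d + 1) (by omega)
    exact (ih (by omega) a ha c hc).trans (h2 (i + d + 1) hk c hc b hb)

lemma sch_nonneg (nrm : (ℕ →₀ ℝ) → ℝ) (h : IsSchlumprechtNorm nrm) (ξ : ℕ →₀ ℝ) : 0 ≤ nrm ξ := by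
  obtain ⟨ha, hs, h0, -⟩ := h
  have h1 := ha ξ ((-1 : ℝ) • ξ)
  rw [hs] at h1
  have h2 : ξ + (-1 : ℝ) • ξ = 0 := by simp
  rw [h2, (h0 0).2 rfl] at h1
  norm_num at h1
  linarith

lemma sch_restr_le (nrm : (ℕ →₀ ℝ) → ℝ) (h : IsSchlumprechtNorm nrm) (y : ℕ →₀ ℝ) (E : Finset ℕ) :
    nrm (restrF E y) ≤
      ∑ i ∈ y.support, if i ∈ E then |y i| * nrm (Finsupp.single i 1) else 0 := by
  have key : restrF E y = ∑ i ∈ y.support, if i ∈ E then y i • Finsupp.single i (1:ℝ) else 0 := by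
    ext m
    rw [Finsupp.finsetSum_apply]
    by_cases hm : m ∈ y.support
    · rw [Finset.sum_eq_single m]
      · by_cases hE : m ∈ E <;> simp [restrF, hE]
      · intro b _ hb
        split_ifs <;> simp [hb]
      · exact fun h => absurd hm h
    · rw [Finset.sum_eq_zero]
      · simp [restrF, Finsupp.filter_apply]; intro _; simpa using hm
      · intro b hb
        have : b ≠ m := fun e => hm (e ▸ hb)
        split_ifs <;> simp [this]
  rw [key]
  refine (Finset.le_sum_of_subadditive nrm ((h.2.2.1 0).2 rfl).le h.1 _ _).trans ?_
  refine Finset.sum_le_sum fun i _ => ?_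
  split_ifs
  · rw [h.2.1]
  · exact ((h.2.2.1 0).2 rfl).le

lemma sch_bdd (nrm : (ℕ →₀ ℝ) → ℝ) (h : IsSchlumprechtNorm nrm) (y : ℕ →₀ ℝ) :
    BddAbove (schlumprechtSet nrm y) := by
  refine ⟨∑ i ∈ y.support, |y i| * nrm (Finsupp.single i 1), ?_⟩
  rintro r ⟨k, E, hk, h1, h2, rfl⟩
  have hk' : (2:ℝ) ≤ k := by exact_mod_cast hk
  have hlog : 1 ≤ Real.logb 2 (k + 1) := by
    rw [Real.le_logb_iff_rpow_le (by norm_num) (by linarith)]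
    simp; linarith
  have hS : 0 ≤ ∑ j ∈ Finset.range k, nrm (restrF (E j) y) :=
    Finset.sum_nonneg fun _ _ => sch_nonneg nrm h _
  have hle : (1 / Real.logb 2 (k + 1)) ≤ 1 := by
    rw [div_le_one (by linarith)]; exact hlog
  refine (mul_le_of_le_one_left hS hle).trans ?_
  refine (Finset.sum_le_sum fun j _ => sch_restr_le nrm h y (E j)).trans ?_
  rw [Finset.sum_comm]
  refine Finset.sum_le_sum fun i _ => ?_
  have hw : 0 ≤ |y i| * nrm (Finsupp.single i 1) := mul_nonneg (abs_nonneg _) (sch_nonneg nrm h _)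
  rw [← Finset.sum_filter, Finset.sum_const, nsmul_eq_mul]
  refine mul_le_of_le_one_left hw ?_
  have : (Finset.filter (fun j => i ∈ E j) (Finset.range k)).card ≤ 1 := by
    rw [Finset.card_le_one]
    have aux : ∀ a b, a < b → b < k → i ∈ E a → i ∈ E b → False := by
      intro a b hab hb ha hb'
      obtain ⟨d, rfl⟩ := Nat.exists_eq_add_of_lt hab
      exact lt_irrefl _ (sch_chain_lt k E h1 h2 a d hb i ha i hb')
    intro a ha b hb
    simp only [Finset.mem_filter, Finset.mem_range] at ha hb
    rcases lt_trichotomy a b with hab | hab | hab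
    · exact (aux a b hab hb.1 ha.2 hb.2).elim
    · exact hab
    · exact (aux b a hab ha.1 hb.2 ha.2).elim
  exact_mod_cast this

lemma sch_abs_le (nrm : (ℕ →₀ ℝ) → ℝ) (h : IsSchlumprechtNorm nrm) (y : ℕ →₀ ℝ) (i : ℕ) :
    |y i| ≤ nrm y := by
  rw [h.2.2.2 y]
  refine le_max_of_le_left ?_
  refine le_ciSup (f := fun i => |y i|) ⟨∑ j ∈ y.support, |y j|, ?_⟩ i
  rintro _ ⟨m, rfl⟩
  by_cases hm : m ∈ y.support
  · exact Finset.single_le_sum (f := fun j => |y j|) (fun _ _ => abs_nonneg _) hm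
  · have : y m = 0 := by simpa using hm
    simp only [this, abs_zero]
    exact Finset.sum_nonneg fun _ _ => abs_nonneg _

theorem schlumprecht_head_tail_estimate (nrm : (ℕ →₀ ℝ) → ℝ) (h : IsSchlumprechtNorm nrm)
    (y : ℕ →₀ ℝ) (hy : nrm y ≤ 1) (n : ℕ) (hn : 1 ≤ n) :
    ∑ i ∈ Finset.Icc 1 n, |y i| + nrm (y - Finsupp.filter (· ≤ n) y)
      ≤ Real.logb 2 (n + 2) := by
  let T : Finset ℕ := insert (n + 1) (y.support.filter (fun i => n < i))
  have hT : ∀ b ∈ T, n < b := by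
    intro b hb
    simp only [T, Finset.mem_insert, Finset.mem_filter] at hb
    omega
  let E : ℕ → Finset ℕ := fun j => if j < n then {j + 1} else T
  have hmem : (1 / Real.logb 2 ((n + 1 : ℕ) + 1)) *
      ∑ j ∈ Finset.range (n + 1), nrm (restrF (E j) y) ∈ schlumprechtSet nrm y := by
    refine ⟨n + 1, E, by omega, ?_, ?_, rfl⟩
    · intro j _
      by_cases hj : j < n
      · simp [E, hj]
      · simp [E, hj, T]
    · intro j hj a ha b hb
      have hj' : j < n := by omega
      simp only [E, hj', if_true, Finset.mem_singleton] at ha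
      by_cases hj2 : j + 1 < n
      · simp only [E, hj2, if_true, Finset.mem_singleton] at hb
        omega
      · simp only [E, hj2, if_false] at hb
        have := hT b hb
        omega
  have h1 : (1 / Real.logb 2 ((n + 1 : ℕ) + 1)) *
      ∑ j ∈ Finset.range (n + 1), nrm (restrF (E j) y) ≤ 1 := by
    refine (le_csSup (sch_bdd nrm h y) hmem).trans (le_trans ?_ hy)
    rw [h.2.2.2 y]
    exact le_max_right _ _
  have hcast : (((n + 1 : ℕ) : ℝ) + 1) = n + 2 := by push_cast; ring
  rw [hcast] at h1
  have hlog : 0 < Real.logb 2 ((n:ℝ) + 2) :=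
    Real.logb_pos (by norm_num) (by have : (0:ℝ) ≤ n := n.cast_nonneg; linarith)
  rw [one_div, inv_mul_le_iff₀ hlog, mul_one, Finset.sum_range_succ] at h1
  refine le_trans (add_le_add ?_ (le_of_eq ?_)) h1
  · rw [← Finset.Ico_add_one_right_eq_Icc, Finset.sum_Ico_eq_sum_range]
    simp only [Nat.add_sub_cancel]
    refine Finset.sum_le_sum fun j hj => ?_
    have hj' : j < n := Finset.mem_range.1 hj
    have := sch_abs_le nrm h (restrF (E j) y) (1 + j)
    simpa [restrF, E, hj', Finsupp.filter_apply, add_comm] using this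
  · congr 1
    ext m
    by_cases hm : m ≤ n
    · have : m ∉ T := fun hc => by have := hT m hc; omega
      simp [restrF, E, Finsupp.filter_apply, hm, this]
    · by_cases hs : y m = 0
      · simp [restrF, E, Finsupp.filter_apply, hs]
      · have : m ∈ T := by
          simp only [T, Finset.mem_insert, Finset.mem_filter, Finsupp.mem_support_iff]
          exact Or.inr ⟨hs, by omega⟩
        simp [restrF, E, Finsupp.filter_apply, hm, this]
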